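/- Let J be a many-sorted closure operator on an S-sorted set A and n ∈ ℕ. Then J is n-ary and uniform if, and only if, there exist an S-sorted signature Σ and a Σ-algebra 𝐀 with underlying S-sorted set A such that J = Sg_𝐀 and every operation of 𝐀 is of arity ≤ n (i.e., Σ_{w,s} = ∅ whenever |w| > n). -/

import Mathlib

universe u v w

namespace ManySorted

variable {S : Type u}

/-- The delta of Kronecker `δ^{t,x}`: the S-sorted set whose `t`-th coordinate is `{x}`
and whose other coordinates are empty. -/
def delta {α : S → Type v} (t : S) (x : α t) : ∀ s, Set (α s) :=
  fun s => {y | (⟨s, y⟩ : Σ s, α s) = ⟨t, x⟩}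

/-- The cardinal of an S-sorted set: the cardinal of its coproduct. -/
def scard {α : S → Type v} (X : ∀ s, Set (α s)) : Cardinal.{max u v} :=
  Cardinal.mk (Σ s, ↥(X s))

/-- The support of an S-sorted set. -/
def supp {α : S → Type v} (X : ∀ s, Set (α s)) : Set S := {s | (X s).Nonempty}

section Closure

variable {α : S → Type v}

/-- `J` is a many-sorted closure operator: extensive, isotone and idempotent. -/
def IsClosureOp (J : (∀ s, Set (α s)) → (∀ s, Set (α s))) : Prop :=
  (∀ X s, X s ⊆ J X s) ∧
  (∀ X Y, (∀ s, X s ⊆ Y s) → ∀ s, J X s ⊆ J Y s) ∧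
  (∀ X, J (J X) = J X)

/-- The operator `J_{≤n}`. -/
def Jle (J : (∀ s, Set (α s)) → (∀ s, Set (α s))) (n : ℕ)
    (X : ∀ s, Set (α s)) : ∀ s, Set (α s) :=
  fun s => ⋃ (Y : ∀ s, Set (α s)) (_ : (∀ t, Y t ⊆ X t) ∧ scard Y ≤ (n : Cardinal)), J Y s

/-- The iterates `J_{≤n}^m`. -/
def JleIter (J : (∀ s, Set (α s)) → (∀ s, Set (α s))) (n : ℕ) :
    ℕ → (∀ s, Set (α s)) → (∀ s, Set (α s))
  | 0 => fun X => X
  | k + 1 => fun X => Jle J n (JleIter J n k X)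

/-- The operator `J_{≤n}^ω`. -/
def Jlomega (J : (∀ s, Set (α s)) → (∀ s, Set (α s))) (n : ℕ)
    (X : ∀ s, Set (α s)) : ∀ s, Set (α s) :=
  fun s => ⋃ m : ℕ, JleIter J n m X s

/-- `J` is an `n`-ary many-sorted closure operator if `J = J_{≤n}^ω`. -/
def IsNary (n : ℕ) (J : (∀ s, Set (α s)) → (∀ s, Set (α s))) : Prop :=
  J = Jlomega J n

/-- `J` is algebraic. -/
def Algebraic (J : (∀ s, Set (α s)) → (∀ s, Set (α s))) : Prop :=
  ∀ X, J X = fun s =>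
    ⋃ (K : ∀ s, Set (α s)) (_ : (∀ t, K t ⊆ X t) ∧ scard K < Cardinal.aleph0), J K s

/-- `J` is uniform. -/
def Uniform (J : (∀ s, Set (α s)) → (∀ s, Set (α s))) : Prop :=
  ∀ X Y, supp X = supp Y → supp (J X) = supp (J Y)

/-- `X` is irredundant (independent) with respect to `J`. -/
def Irredundant (J : (∀ s, Set (α s)) → (∀ s, Set (α s)))
    (X : ∀ s, Set (α s)) : Prop :=
  ∀ s, ∀ x ∈ X s, x ∉ J (fun t => X t \ delta s x t) s

/-- `X` is a basis (generator) with respect to `J`. -/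
def IsBasis (J : (∀ s, Set (α s)) → (∀ s, Set (α s)))
    (X : ∀ s, Set (α s)) : Prop :=
  ∀ s, J X s = Set.univ

/-- `IrB (A, J)`: the set of natural numbers that are the cardinal of an irredundant basis. -/
def IrB (J : (∀ s, Set (α s)) → (∀ s, Set (α s))) : Set ℕ :=
  {n | ∃ X : ∀ s, Set (α s), Irredundant J X ∧ IsBasis J X ∧ scard X = (n : Cardinal)}

end Closure

section Algebra

variable {α : S → Type v}

/-- `X` is closed under all the operations of the algebra `(A, F)`. -/
def Closed (Sig : List S → S → Type w)
    (F : ∀ w s, Sig w s → ((∀ i : Fin w.length, α (w.get i)) → α s))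
    (X : ∀ s, Set (α s)) : Prop :=
  ∀ (w : List S) (s : S) (σ : Sig w s) (a : ∀ i : Fin w.length, α (w.get i)),
    (∀ i, a i ∈ X (w.get i)) → F w s σ a ∈ X s

/-- The subalgebra generating operator `Sg`. -/
def Sg (Sig : List S → S → Type w)
    (F : ∀ w s, Sig w s → ((∀ i : Fin w.length, α (w.get i)) → α s))
    (X : ∀ s, Set (α s)) : ∀ s, Set (α s) :=
  fun s => ⋂ (C : ∀ s, Set (α s)) (_ : Closed Sig F C ∧ ∀ t, X t ⊆ C t), C s

/-- The one-step operator `E_𝐀`. -/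
def Estep (Sig : List S → S → Type w)
    (F : ∀ w s, Sig w s → ((∀ i : Fin w.length, α (w.get i)) → α s))
    (X : ∀ s, Set (α s)) : ∀ s, Set (α s) :=
  fun s => X s ∪ {y | ∃ (w : List S) (σ : Sig w s) (a : ∀ i : Fin w.length, α (w.get i)),
    (∀ i, a i ∈ X (w.get i)) ∧ F w s σ a = y}

/-- The iterates `E_𝐀^n`. -/
def Eiter (Sig : List S → S → Type w)
    (F : ∀ w s, Sig w s → ((∀ i : Fin w.length, α (w.get i)) → α s)) :
    ℕ → (∀ s, Set (α s)) → (∀ s, Set (α s))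
  | 0 => fun X => X
  | k + 1 => fun X => Estep Sig F (Eiter Sig F k X)

/-- `E_𝐀^ω`. -/
def Eomega (Sig : List S → S → Type w)
    (F : ∀ w s, Sig w s → ((∀ i : Fin w.length, α (w.get i)) → α s))
    (X : ∀ s, Set (α s)) : ∀ s, Set (α s) :=
  fun s => ⋃ n : ℕ, Eiter Sig F n X s

end Algebra

end ManySorted

namespace ManySorted

variable {S : Type u} {α : S → Type v}

/-- The S-sorted set of the values of a tuple. -/
def tupleRange {w : List S} (a : ∀ i : Fin w.length, α (w.get i)) : ∀ s, Set (α s) :=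
  fun s => {y | ∃ i, (⟨w.get i, a i⟩ : Σ s, α s) = ⟨s, y⟩}

theorem mem_tupleRange {w : List S} (a : ∀ i : Fin w.length, α (w.get i))
    (i : Fin w.length) : a i ∈ tupleRange a (w.get i) :=
  ⟨i, rfl⟩

theorem tupleRange_subset {w : List S} {a : ∀ i : Fin w.length, α (w.get i)}
    {X : ∀ s, Set (α s)} (h : ∀ i, a i ∈ X (w.get i)) (s : S) : tupleRange a s ⊆ X s := by
  rintro y ⟨i, hi⟩
  have key : ∀ x : Σ s, α s, (⟨w.get i, a i⟩ : Σ s, α s) = x → x.2 ∈ X x.1 := by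
    rintro x rfl
    exact h i
  exact key ⟨s, y⟩ hi

theorem supp_tupleRange {w : List S} (a : ∀ i : Fin w.length, α (w.get i)) :
    supp (tupleRange a) = {s | s ∈ w} := by
  ext s
  constructor
  · rintro ⟨y, i, hi⟩
    have h : w.get i = s := congrArg Sigma.fst hi
    exact h ▸ w.get_mem i
  · intro hs
    obtain ⟨i, rfl⟩ := List.get_of_mem hs
    exact ⟨a i, mem_tupleRange a i⟩

theorem scard_tupleRange_le {w : List S} (a : ∀ i : Fin w.length, α (w.get i)) :
    scard (tupleRange a) ≤ (w.length : Cardinal) := by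
  let f : ULift.{max u v} (Fin w.length) → Σ s, ↥(tupleRange a s) :=
    fun i => ⟨w.get i.down, a i.down, mem_tupleRange a i.down⟩
  have hf : Function.Surjective f := by
    rintro ⟨s, y, i, hi⟩
    obtain ⟨rfl, h⟩ := Sigma.mk.inj_iff.mp hi
    obtain rfl := eq_of_heq h
    exact ⟨⟨i⟩, rfl⟩
  simpa [scard] using Cardinal.mk_le_of_surjective hf

/-- Every S-sorted set with at most `n` elements is the range of a tuple of length at most `n`. -/
theorem exists_tupleRange_eq {Y : ∀ s, Set (α s)} {n : ℕ} (hY : scard Y ≤ (n : Cardinal)) :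
    ∃ (w : List S) (a : ∀ i : Fin w.length, α (w.get i)),
      w.length ≤ n ∧ tupleRange a = Y := by
  have hfin : Finite (Σ s, ↥(Y s)) :=
    Cardinal.lt_aleph0_iff_finite.mp (hY.trans_lt Cardinal.natCast_lt_aleph0)
  have := Fintype.ofFinite (Σ s, ↥(Y s))
  let l : List (Σ s, ↥(Y s)) := Finset.univ.toList
  have hl : l.length ≤ n := by
    have h : Fintype.card (Σ s, ↥(Y s)) ≤ n := by
      simpa [scard, Cardinal.mk_fintype] using hY
    simpa [l] using h
  have hlen : (l.map Sigma.fst).length = l.length := List.length_map ..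
  have exists_fiber : ∀ (t : S) (x : Σ s, ↥(Y s)), t = x.1 →
      ∃ y : α t, (⟨t, y⟩ : Σ s, α s) = ⟨x.1, x.2.1⟩ := by
    rintro t x rfl
    exact ⟨x.2.1, rfl⟩
  choose a ha using fun i : Fin (l.map Sigma.fst).length =>
    exists_fiber ((l.map Sigma.fst).get i) (l.get (i.cast hlen)) (by simp)
  refine ⟨l.map Sigma.fst, a, hlen.trans_le hl, ?_⟩
  funext s
  ext y
  constructor
  · rintro ⟨i, hi⟩
    obtain ⟨rfl, h⟩ := Sigma.mk.inj_iff.mp ((ha i).symm.trans hi)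
    rw [← eq_of_heq h]
    exact (l.get (i.cast hlen)).2.2
  · intro hy
    obtain ⟨i, hi⟩ := List.get_of_mem
      (show (⟨s, y, hy⟩ : Σ s, ↥(Y s)) ∈ l from Finset.mem_toList.mpr (Finset.mem_univ _))
    refine ⟨i.cast hlen.symm, (ha _).trans ?_⟩
    change (⟨(l.get i).1, (l.get i).2.1⟩ : Σ s, α s) = ⟨s, y⟩
    rw [hi]

section Sg

variable {Sig : List S → S → Type w}
  {F : ∀ w s, Sig w s → ((∀ i : Fin w.length, α (w.get i)) → α s)}

theorem closed_Sg (X : ∀ s, Set (α s)) : Closed Sig F (Sg Sig F X) := by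
  intro w s σ a ha
  simp only [Sg, Set.mem_iInter] at ha ⊢
  exact fun C hC => hC.1 w s σ a fun i => ha i C hC

theorem subset_Sg (X : ∀ s, Set (α s)) (s : S) : X s ⊆ Sg Sig F X s :=
  Set.subset_iInter₂ fun _ hC => hC.2 s

theorem Sg_subset {X C : ∀ s, Set (α s)} (hC : Closed Sig F C) (h : ∀ s, X s ⊆ C s) (s : S) :
    Sg Sig F X s ⊆ C s :=
  Set.iInter₂_subset C ⟨hC, h⟩

theorem supp_Sg_subset {X Y : ∀ s, Set (α s)} (h : supp X ⊆ supp Y) :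
    supp (Sg Sig F X) ⊆ supp (Sg Sig F Y) := by
  have hC : Closed Sig F fun s => {_y : α s | s ∈ supp (Sg Sig F Y)} := by
    intro w s σ a ha
    choose b hb using ha
    exact ⟨_, closed_Sg Y w s σ b hb⟩
  rintro s ⟨x, hx⟩
  refine Sg_subset hC (fun t y hy => ?_) s hx
  obtain ⟨z, hz⟩ := h ⟨y, hy⟩
  exact ⟨z, subset_Sg Y t hz⟩

theorem uniform_Sg : Uniform (Sg Sig F) := fun _ _ h =>
  (supp_Sg_subset h.subset).antisymm (supp_Sg_subset h.symm.subset)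

end Sg

variable {J : (∀ s, Set (α s)) → (∀ s, Set (α s))}

theorem subset_Jle {X Y : ∀ s, Set (α s)} {n : ℕ} (h : ∀ t, Y t ⊆ X t)
    (hY : scard Y ≤ (n : Cardinal)) (s : S) : J Y s ⊆ Jle J n X s :=
  Set.subset_iUnion₂_of_subset Y ⟨h, hY⟩ subset_rfl

theorem Jlomega_subset {X C : ∀ s, Set (α s)} {n : ℕ} (hX : ∀ s, X s ⊆ C s)
    (hC : ∀ Y : ∀ s, Set (α s), (∀ s, Y s ⊆ C s) → scard Y ≤ (n : Cardinal) →
      ∀ s, J Y s ⊆ C s) (s : S) : Jlomega J n X s ⊆ C s := by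
  refine Set.iUnion_subset fun m => ?_
  induction m generalizing s with
  | zero => exact hX s
  | succ m ih =>
    exact Set.iUnion₂_subset fun Y hY => hC Y (fun t => (hY.1 t).trans (ih t)) hY.2 s

theorem subset_Jle_self (hJ : ∀ X s, X s ⊆ J X s) {n : ℕ} (hn : 1 ≤ n)
    (X : ∀ s, Set (α s)) (s : S) : X s ⊆ Jle J n X s := by
  intro x hx
  let a : ∀ i : Fin [s].length, α ([s].get i) := Fin.cons x fun i => i.elim0
  have ha : ∀ i, a i ∈ X ([s].get i) := Fin.cases hx fun i => i.elim0
  refine subset_Jle (tupleRange_subset ha) ?_ s (hJ _ s (mem_tupleRange a 0))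
  exact (scard_tupleRange_le a).trans (by exact_mod_cast hn)

theorem monotone_JleIter (hJ : ∀ X s, X s ⊆ J X s) {n : ℕ} (hn : 1 ≤ n)
    (X : ∀ s, Set (α s)) (s : S) : Monotone fun m => JleIter J n m X s :=
  monotone_nat_of_le_succ fun _ => subset_Jle_self hJ hn _ s

theorem exists_forall_mem_JleIter (hJ : ∀ X s, X s ⊆ J X s) {n : ℕ} {X : ∀ s, Set (α s)}
    {w : List S} (hw : w.length ≤ n) {a : ∀ i : Fin w.length, α (w.get i)}
    (ha : ∀ i, a i ∈ Jlomega J n X (w.get i)) :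
    ∃ m, ∀ i, a i ∈ JleIter J n m X (w.get i) := by
  choose m hm using fun i => Set.mem_iUnion.mp (ha i)
  refine ⟨Finset.univ.sup m, fun i => ?_⟩
  exact monotone_JleIter hJ (i.pos.trans_le hw) X _ (Finset.le_sup (Finset.mem_univ i)) (hm i)

theorem Jlomega_subset_self (hJ : IsClosureOp J) (n : ℕ) (X : ∀ s, Set (α s)) (s : S) :
    Jlomega J n X s ⊆ J X s :=
  Jlomega_subset (hJ.1 X)
    (fun Y hY _ s => (hJ.2.1 Y (J X) hY s).trans (congrFun (hJ.2.2 X) s).subset) s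

theorem isNary_Sg {Sig : List S → S → Type w}
    {F : ∀ w s, Sig w s → ((∀ i : Fin w.length, α (w.get i)) → α s)} {n : ℕ}
    (hJ : IsClosureOp (Sg Sig F))
    (hn : ∀ (w : List S) (s : S), n < w.length → IsEmpty (Sig w s)) :
    IsNary n (Sg Sig F) := by
  funext X s
  refine (Sg_subset ?_ (fun t => ?_) s).antisymm (Jlomega_subset_self hJ n X s)
  · intro w s σ a ha
    have hw : w.length ≤ n := not_lt.mp fun h => (hn w s h).false σ
    obtain ⟨m, hm⟩ := exists_forall_mem_JleIter hJ.1 hw ha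
    refine Set.mem_iUnion.mpr ⟨m + 1, subset_Jle (tupleRange_subset hm) ?_ s
      (closed_Sg (tupleRange a) w s σ a fun i => subset_Sg _ _ (mem_tupleRange a i))⟩
    exact (scard_tupleRange_le a).trans (by exact_mod_cast hw)
  · exact Set.subset_iUnion (fun m => JleIter (Sg Sig F) n m X t) 0

/-- The operations of arity at most `n` that send every tuple into the `J`-closure of its range. -/
def CompatibleOp (J : (∀ s, Set (α s)) → (∀ s, Set (α s))) (n : ℕ) (w : List S) (s : S) :
    Type (max u v) :=
  ULift.{u} {f : (∀ i : Fin w.length, α (w.get i)) → α s //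
    w.length ≤ n ∧ ∀ a, f a ∈ J (tupleRange a) s}

/-- The tautological action of the operations compatible with `J`. -/
def CompatibleOp.apply (J : (∀ s, Set (α s)) → (∀ s, Set (α s))) (n : ℕ) (w : List S) (s : S)
    (σ : CompatibleOp J n w s) : (∀ i : Fin w.length, α (w.get i)) → α s :=
  σ.down.1

theorem exists_compatibleOp_apply_eq (hU : Uniform J) {n : ℕ} {w : List S} (hw : w.length ≤ n)
    (a : ∀ i : Fin w.length, α (w.get i)) {s : S} {y : α s} (hy : y ∈ J (tupleRange a) s) :
    ∃ σ : CompatibleOp J n w s, CompatibleOp.apply J n w s σ a = y := by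
  classical
  have hne : ∀ b : ∀ i : Fin w.length, α (w.get i), (J (tupleRange b) s).Nonempty := fun b =>
    (hU _ _ ((supp_tupleRange a).trans (supp_tupleRange b).symm)).subset ⟨y, hy⟩
  choose f hf using hne
  refine ⟨⟨⟨Function.update f a y, hw, fun b => ?_⟩⟩, Function.update_self ..⟩
  by_cases h : b = a
  · subst h
    rwa [Function.update_self]
  · rw [Function.update_of_ne h]
    exact hf b

theorem eq_Sg_compatibleOp (hJ : IsClosureOp J) {n : ℕ} (hN : IsNary n J) (hU : Uniform J) :
    J = Sg (CompatibleOp J n) (CompatibleOp.apply J n) := by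
  funext X s
  refine Set.Subset.antisymm ?_ (Sg_subset ?_ (hJ.1 X) s)
  · refine (congrFun (congrFun hN X) s).subset.trans
      (Jlomega_subset (subset_Sg X) (fun Y hY hc s y hy => ?_) s)
    obtain ⟨w, a, hw, rfl⟩ := exists_tupleRange_eq hc
    obtain ⟨σ, rfl⟩ := exists_compatibleOp_apply_eq hU hw a hy
    exact closed_Sg X w s σ a fun i => hY _ (mem_tupleRange a i)
  · intro w s σ a ha
    rw [← hJ.2.2 X]
    exact hJ.2.1 _ _ (tupleRange_subset ha) s (σ.down.2.2 a)

end ManySorted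

open ManySorted in
/-- `J` is `n`-ary and uniform iff `J = Sg_𝐀` for some signature `Σ` and
`Σ`-algebra `𝐀` on `A` all of whose operations are of arity `≤ n`. -/
theorem statement_17 {S : Type u} {α : S → Type v}
    (J : (∀ s, Set (α s)) → (∀ s, Set (α s))) (hJ : IsClosureOp J) (n : ℕ) :
    (IsNary n J ∧ Uniform J) ↔
      ∃ (Sig : List S → S → Type (max u v))
        (F : ∀ w s, Sig w s → ((∀ i : Fin w.length, α (w.get i)) → α s)),
        J = Sg Sig F ∧ ∀ (w : List S) (s : S), n < w.length → IsEmpty (Sig w s) := by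
  constructor
  · rintro ⟨hN, hU⟩
    exact ⟨CompatibleOp J n, CompatibleOp.apply J n, eq_Sg_compatibleOp hJ hN hU,
      fun w s h => ⟨fun σ => h.not_ge σ.down.2.1⟩⟩
  · rintro ⟨Sig, F, rfl, hn⟩
    exact ⟨isNary_Sg hJ hn, uniform_Sg⟩
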